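/- arXiv:2009.13978 — 5 statements merged into one kernel-verified Lean document; each statement's English description precedes it below -/
import Mathlib

section
/- Correctness of the ID-SDVBS scheme: let s, r, x, y, h ∈ ZMod q with x ≠ 0, and let Q_S, Q_V ∈ G1. Set S_S = s•Q_S, S_V = s•Q_V, U = r•Q_S, U' = x•U + (x·y)•Q_S, h₁ = x⁻¹·h + y, V = (r + h₁)•S_S, V' = x•V, and σ = e(V', Q_V). Then the verification equation holds: σ = e(U' + h•Q_S, S_V). -/
/-- A biadditive map from a `ZMod q`-module to a commutative group is balanced over `ZMod q`. -/
theorem biadditive_smul_left_eq_smul_right {q : ℕ} [NeZero q]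
    {G1 : Type*} [AddCommGroup G1] [Module (ZMod q) G1] {G2 : Type*} [CommGroup G2]
    {e : G1 → G1 → G2}
    (he_left : ∀ A B C : G1, e (A + B) C = e A C * e B C)
    (he_right : ∀ A B C : G1, e A (B + C) = e A B * e A C)
    (s : ZMod q) (A B : G1) : e (s • A) B = e A (s • B) := by
  have nsmul_balanced (n : ℕ) : e (n • A) B = e A (n • B) := by
    induction n with
    | zero =>
      have h_left : e 0 B = 1 := by simpa using he_left 0 0 B
      have h_right : e A 0 = 1 := by simpa using he_right A 0 0
      rw [zero_smul, zero_smul, h_left, h_right]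
    | succ n ih => rw [succ_nsmul, succ_nsmul, he_left, he_right, ih]
  rw [← ZMod.natCast_zmod_val s, Nat.cast_smul_eq_nsmul, Nat.cast_smul_eq_nsmul]
  exact nsmul_balanced s.val


/-- Correctness of the ID-SDVBS scheme: the unblinded signature
`σ = e(V', Q_V)` satisfies the designated verification equation
`σ = e(U' + h • Q_S, S_V)`. -/
theorem idsdvbs_correctness (q : ℕ) [Fact q.Prime]
    (G1 : Type*) [AddCommGroup G1] [Module (ZMod q) G1]
    (G2 : Type*) [CommGroup G2]
    (hexp : ∀ g : G2, g ^ q = 1)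
    (e : G1 → G1 → G2)
    (he_left : ∀ A B C : G1, e (A + B) C = e A C * e B C)
    (he_right : ∀ A B C : G1, e A (B + C) = e A B * e A C)
    (s r x y h : ZMod q) (hx : x ≠ 0) (QS QV : G1)
    (SS SV U U' V V' : G1) (h₁ : ZMod q) (σ : G2)
    (hSS : SS = s • QS) (hSV : SV = s • QV)
    (hU : U = r • QS)
    (hU' : U' = x • U + (x * y) • QS)
    (hh₁ : h₁ = x⁻¹ * h + y)
    (hV : V = (r + h₁) • SS)
    (hV' : V' = x • V)
    (hσ : σ = e V' QV) :
    σ = e (U' + h • QS) SV := by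
  have unblind : V' = s • (U' + h • QS) := by
    subst hSS hU hU' hh₁ hV hV'
    simp only [smul_smul, ← add_smul]
    congr 1
    field_simp
    ring
  rw [hσ, unblind, hSV, biadditive_smul_left_eq_smul_right he_left he_right]
end

section
/- Validity of the simulated signatures produced during signature queries in the unforgeability reduction: let s, x, h ∈ ZMod q and P, Q_S, Q_V ∈ G1. Set P_pub = s•P, S_S = s•Q_S, S_V = s•Q_V, U' = x•P, V' = x•P_pub + h•S_S, and σ = e(V', Q_V). Then σ = e(U' + h•Q_S, S_V), i.e. the pair (U', σ) passes the designated verification equation. -/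
/-- A map from an additive monoid to a group turning sums into products turns natural multiples
into powers. -/
theorem map_nsmul_eq_pow_of_map_add {A G : Type*} [AddMonoid A] [Group G] (f : A → G)
    (hf : ∀ a b, f (a + b) = f a * f b) (n : ℕ) (a : A) : f (n • a) = f a ^ n := by
  induction n with
  | zero => simpa using hf 0 0
  | succ n ih => rw [succ_nsmul, hf, ih, pow_succ]

/-- Scalars of `ZMod q` can be moved from one argument of a pairing to the other. -/
theorem pairing_zmod_smul_comm {q : ℕ} [NeZero q] {A B G : Type*}
    [AddCommGroup A] [Module (ZMod q) A] [AddCommGroup B] [Module (ZMod q) B] [Group G]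
    (e : A → B → G)
    (he_left : ∀ a a' b, e (a + a') b = e a b * e a' b)
    (he_right : ∀ a b b', e a (b + b') = e a b * e a b')
    (s : ZMod q) (a : A) (b : B) : e (s • a) b = e a (s • b) := by
  rw [← ZMod.natCast_zmod_val s, Nat.cast_smul_eq_nsmul, Nat.cast_smul_eq_nsmul,
    map_nsmul_eq_pow_of_map_add (e · b) (he_left · · b),
    map_nsmul_eq_pow_of_map_add (e a) (he_right a)]

/-- Validity of the simulated signatures produced during signature queries in the
unforgeability reduction: with `P_pub = s • P`, `S_S = s • Q_S`, `S_V = s • Q_V`,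
`U' = x • P`, `V' = x • P_pub + h • S_S` and `σ = e(V', Q_V)`, the pair `(U', σ)`
passes the designated verification equation `σ = e(U' + h • Q_S, S_V)`. -/
theorem simulated_signature_valid (q : ℕ) [Fact q.Prime]
    (G1 : Type*) [AddCommGroup G1] [Module (ZMod q) G1]
    (G2 : Type*) [CommGroup G2]
    (hexp : ∀ g : G2, g ^ q = 1)
    (e : G1 → G1 → G2)
    (he_left : ∀ A B C : G1, e (A + B) C = e A C * e B C)
    (he_right : ∀ A B C : G1, e A (B + C) = e A B * e A C)
    (s x h : ZMod q) (P QS QV : G1)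
    (Ppub SS SV U' V' : G1) (σ : G2)
    (hPpub : Ppub = s • P)
    (hSS : SS = s • QS) (hSV : SV = s • QV)
    (hU' : U' = x • P)
    (hV' : V' = x • Ppub + h • SS)
    (hσ : σ = e V' QV) :
    σ = e (U' + h • QS) SV := by
  subst hPpub hSS hSV hU' hV' hσ
  rw [← pairing_zmod_smul_comm e he_left he_right, smul_add, smul_comm x s, smul_comm h s]
end

section
/- Extraction of the BDHP solution from two forgeries (core of the unforgeability reduction, Theorem 1): let P ∈ G1, a, b, c ∈ ZMod q, and set Q_S = a•P and S_V = (b·c)•P. Let U' ∈ G1 and h*, h' ∈ ZMod q with h* ≠ h', and set σ* = e(U' + h*•Q_S, S_V) and σ' = e(U' + h'•Q_S, S_V). Then (σ* / σ')^((h* − h')⁻¹) = e(P, P)^(a·b·c), where the inverse (h* − h')⁻¹ is taken in the field ZMod q. -/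
theorem map_zmod_smul_eq_pow_val {q : ℕ} [NeZero q] {M G : Type*} [AddCommGroup M]
    [Module (ZMod q) M] [CommGroup G] {f : M → G} (hf : ∀ A B, f (A + B) = f A * f B)
    (x : ZMod q) (A : M) : f (x • A) = f A ^ x.val := by
  have h := (AddMonoidHom.mk' (fun A => Additive.ofMul (f A)) hf).map_nsmul x.val A
  rw [← Nat.cast_smul_eq_nsmul (ZMod q), ZMod.natCast_zmod_val] at h
  exact h

theorem pow_zmod_val_mul {q : ℕ} {G : Type*} [Monoid G] {g : G} (hg : g ^ q = 1)
    (x y : ZMod q) : (g ^ x.val) ^ y.val = g ^ (x * y).val := by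
  rw [← pow_mul, ZMod.val_mul, ← pow_eq_pow_mod _ hg]

/-- Extraction of the BDHP solution from two forgeries (core of the unforgeability
reduction): with `Q_S = a • P`, `S_V = (b*c) • P`, and two valid forgeries
`σ* = e(U' + h* • Q_S, S_V)`, `σ' = e(U' + h' • Q_S, S_V)` with `h* ≠ h'`,
one has `(σ* / σ') ^ (h* - h')⁻¹ = e(P,P) ^ (a*b*c)` (exponents via canonical
representatives, inverse in the field `ZMod q`). -/
theorem bdhp_extraction (q : ℕ) [Fact q.Prime]
    (G1 : Type*) [AddCommGroup G1] [Module (ZMod q) G1]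
    (G2 : Type*) [CommGroup G2]
    (hexp : ∀ g : G2, g ^ q = 1)
    (e : G1 → G1 → G2)
    (he_left : ∀ A B C : G1, e (A + B) C = e A C * e B C)
    (he_right : ∀ A B C : G1, e A (B + C) = e A B * e A C)
    (P : G1) (a b c : ZMod q) (QS SV : G1)
    (hQS : QS = a • P) (hSV : SV = (b * c) • P)
    (U' : G1) (hstar h' : ZMod q) (hne : hstar ≠ h')
    (σstar σ' : G2)
    (hσstar : σstar = e (U' + hstar • QS) SV)
    (hσ' : σ' = e (U' + h' • QS) SV) :
    (σstar / σ') ^ ((hstar - h')⁻¹).val = (e P P) ^ (a * b * c).val := by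
  subst hQS hSV hσstar hσ'
  have hdiv : e (U' + hstar • a • P) ((b * c) • P) / e (U' + h' • a • P) ((b * c) • P) =
      e ((hstar - h') • a • P) ((b * c) • P) := by
    rw [div_eq_iff_eq_mul, ← he_left, sub_smul]
    congr 1
    abel
  rw [hdiv, map_zmod_smul_eq_pow_val (f := e _) (he_right _),
    map_zmod_smul_eq_pow_val (f := fun A => e A P) (fun A B => he_left A B P),
    map_zmod_smul_eq_pow_val (f := fun A => e A P) (fun A B => he_left A B P)]
  simp only [pow_zmod_val_mul (hexp _)]
  congr 2
  have := sub_ne_zero.mpr hne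
  field_simp
end

section
/- Strongness (core of Theorem 4): let s, m, x, r, h₁ ∈ ZMod q and Q_S, Q_V* ∈ G1. Set S_S = s•Q_S, Q_V = m•Q_V*, S_S* = m•S_S, Q_S* = m•Q_S, and S_V* = s•Q_V*. Then e(x•(r•S_S) + x•(h₁•S_S), Q_V) = e(x•(r•Q_S*) + x•(h₁•Q_S*), S_V*); that is, the signature designated for V (with public key Q_V) is identically a simulated signature from the signer S* (with public key Q_S*, satisfying S_S* = s•Q_S*) for the designated verifier V* (with secret key S_V*). -/
/-- A pairing that is additive in its first argument turns scalars from `ZMod q` into powers. -/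
theorem pairing_smul_left {q : ℕ} [NeZero q] {G1 G2 : Type*} [AddCommGroup G1]
    [Module (ZMod q) G1] [CommGroup G2] {e : G1 → G1 → G2}
    (he : ∀ A B C : G1, e (A + B) C = e A C * e B C) (c : ZMod q) (A B : G1) :
    e (c • A) B = e A B ^ c.val := by
  let f : G1 →+ Additive G2 := AddMonoidHom.mk' (fun X => Additive.ofMul (e X B))
    fun X Y => congrArg Additive.ofMul (he X Y B)
  have hc : c • A = c.val • A := by
    rw [← Nat.cast_smul_eq_nsmul (ZMod q), ZMod.natCast_zmod_val]
  rw [hc]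
  exact congrArg Additive.toMul (map_nsmul f c.val A)

/-- Scalars from `ZMod q` can be exchanged between the arguments of a bilinear pairing. -/
theorem pairing_smul_smul_comm {q : ℕ} [NeZero q] {G1 G2 : Type*} [AddCommGroup G1]
    [Module (ZMod q) G1] [CommGroup G2] {e : G1 → G1 → G2}
    (he_left : ∀ A B C : G1, e (A + B) C = e A C * e B C)
    (he_right : ∀ A B C : G1, e A (B + C) = e A B * e A C) (a b : ZMod q) (A B : G1) :
    e (a • A) (b • B) = e (b • A) (a • B) := by
  have he_flip (c : ZMod q) : e A (c • B) = e A B ^ c.val :=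
    pairing_smul_left (e := fun X Y => e Y X) (fun X Y Z => he_right Z X Y) c B A
  rw [pairing_smul_left he_left, pairing_smul_left he_left, he_flip, he_flip, pow_right_comm]

/-- Strongness (core): with `S_S = s • Q_S`, `Q_V = m • Q_V*`, `Q_S* = m • Q_S`
and `S_V* = s • Q_V*`, the signature designated for `V` is identically a simulated
signature from the signer `S*` for the designated verifier `V*`:
`e(x•(r•S_S) + x•(h₁•S_S), Q_V) = e(x•(r•Q_S*) + x•(h₁•Q_S*), S_V*)`. -/
theorem strongness (q : ℕ) [Fact q.Prime]
    (G1 : Type*) [AddCommGroup G1] [Module (ZMod q) G1]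
    (G2 : Type*) [CommGroup G2]
    (hexp : ∀ g : G2, g ^ q = 1)
    (e : G1 → G1 → G2)
    (he_left : ∀ A B C : G1, e (A + B) C = e A C * e B C)
    (he_right : ∀ A B C : G1, e A (B + C) = e A B * e A C)
    (s m x r h₁ : ZMod q) (QS QVstar : G1)
    (SS QV SSstar QSstar SVstar : G1)
    (hSS : SS = s • QS)
    (hQV : QV = m • QVstar)
    (hSSstar : SSstar = m • SS)
    (hQSstar : QSstar = m • QS)
    (hSVstar : SVstar = s • QVstar) :
    e (x • (r • SS) + x • (h₁ • SS)) QV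
      = e (x • (r • QSstar) + x • (h₁ • QSstar)) SVstar := by
  have regroup (c : ZMod q) :
      x • (r • (c • QS)) + x • (h₁ • (c • QS)) = c • ((x * r + x * h₁) • QS) := by
    module
  rw [hSS, hQV, hQSstar, hSVstar, regroup, regroup]
  exact pairing_smul_smul_comm he_left he_right s m _ _
end

section
/- Blindness (core of Theorem 5): there always exist blinding factors relating any interactive transcript to any resulting signature. Precisely, let s, h₁ᵢ, r', h'₁ⱼ ∈ ZMod q and Q_S, Q_V, Vᵢ ∈ G1. Set S_S = s•Q_S, S_V = s•Q_V, U'ⱼ = r'•Q_S, V'ⱼ = (r' + h'₁ⱼ)•S_S, X' = Vᵢ − V'ⱼ, and y' = −h₁ᵢ + h'₁ⱼ. Then e(Vᵢ, Q_V) = e(X', Q_V) · e(U'ⱼ + (h₁ᵢ + y')•Q_S, S_V). -/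
/-- A map from a `ZMod q`-module to a monoid that turns sums into products turns scalar
multiplication into exponentiation by the canonical representative. -/
theorem map_zmod_smul_of_map_add {q : ℕ} [NeZero q] {G H : Type*} [AddCommGroup G]
    [Module (ZMod q) G] [Group H] (f : G → H) (hf : ∀ A B : G, f (A + B) = f A * f B)
    (x : ZMod q) (A : G) : f (x • A) = f A ^ x.val := by
  have hx : x • A = x.val • A := by
    rw [← Nat.cast_smul_eq_nsmul (ZMod q), ZMod.natCast_zmod_val]
  rw [hx]
  exact congrArg Additive.toMul
    (map_nsmul (AddMonoidHom.mk' (fun B => Additive.ofMul (f B)) hf) x.val A)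

/-- A biadditive pairing of a `ZMod q`-module with itself is balanced over `ZMod q`. -/
theorem pairing_smul_left_eq_smul_right {q : ℕ} [NeZero q] {G H : Type*} [AddCommGroup G]
    [Module (ZMod q) G] [Group H] (e : G → G → H)
    (he_left : ∀ A B C : G, e (A + B) C = e A C * e B C)
    (he_right : ∀ A B C : G, e A (B + C) = e A B * e A C)
    (x : ZMod q) (A B : G) : e (x • A) B = e A (x • B) := by
  rw [map_zmod_smul_of_map_add (e · B) (fun A₁ A₂ => he_left A₁ A₂ B),
    map_zmod_smul_of_map_add (e A) (he_right A)]


/-- Blindness (core): there always exist blinding factors relating any interactive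
transcript to any resulting signature. With `S_S = s • Q_S`, `S_V = s • Q_V`,
`U'ⱼ = r' • Q_S`, `V'ⱼ = (r' + h'₁ⱼ) • S_S`, `X' = Vᵢ - V'ⱼ` and
`y' = -h₁ᵢ + h'₁ⱼ`, one has
`e(Vᵢ, Q_V) = e(X', Q_V) · e(U'ⱼ + (h₁ᵢ + y') • Q_S, S_V)`. -/
theorem blindness_core (q : ℕ) [Fact q.Prime]
    (G1 : Type*) [AddCommGroup G1] [Module (ZMod q) G1]
    (G2 : Type*) [CommGroup G2]
    (hexp : ∀ g : G2, g ^ q = 1)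
    (e : G1 → G1 → G2)
    (he_left : ∀ A B C : G1, e (A + B) C = e A C * e B C)
    (he_right : ∀ A B C : G1, e A (B + C) = e A B * e A C)
    (s h₁i r' h'₁j : ZMod q) (QS QV Vi : G1)
    (SS SV U'j V'j X' : G1) (y' : ZMod q)
    (hSS : SS = s • QS) (hSV : SV = s • QV)
    (hU'j : U'j = r' • QS)
    (hV'j : V'j = (r' + h'₁j) • SS)
    (hX' : X' = Vi - V'j)
    (hy' : y' = -h₁i + h'₁j) :
    e Vi QV = e X' QV * e (U'j + (h₁i + y') • QS) SV := by
  subst hSS hSV hU'j hV'j hX' hy'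
  rw [← pairing_smul_left_eq_smul_right e he_left he_right, ← he_left]
  congr 1
  module
end
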